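/- arXiv:2003.10344 — 7 statements merged into one kernel-verified Lean document; each statement's English description precedes it below -/
import Mathlib

section
/- Hochschild's formula: Let p be a prime, B a commutative ring in which p = 0 (an F_p-algebra), D : B → B a derivation, and a ∈ B. Then for every x ∈ B, (a•D)^[p](x) = a^p · D^[p](x) + ((a•D)^[p-1](a)) · D(x). In other words, (aD)^p = a^p D^p + ((aD)^{p-1}(a))·D as additive maps B → B. -/
open Finset in
/-- The general Leibniz rule for iterates of a derivation. -/
theorem Derivation.iterate_apply_mul {R B : Type*} [CommRing R] [CommRing B] [Algebra R B]
    (D : Derivation R B B) (n : ℕ) (f g : B) :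
    D^[n] (f * g) = ∑ ij ∈ antidiagonal n, (n.choose ij.1 : B) * (D^[ij.1] f * D^[ij.2] g) := by
  induction n with
  | zero => simp
  | succ n ih =>
    rw [sum_antidiagonal_choose_succ_mul (fun i j => D^[i] f * D^[j] g) n]
    simp only [Function.iterate_succ_apply', ih, map_sum, Derivation.leibniz, smul_eq_mul,
      Derivation.map_natCast, mul_zero, add_zero, mul_add, sum_add_distrib, add_right_inj]
    refine sum_congr rfl fun ⟨i, j⟩ hij ↦ ?_
    rw [n.choose_symm_of_eq_add (mem_antidiagonal.1 hij).symm]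
    ring

open Finset in
/-- In characteristic `p`, the `p`-th iterate of a derivation satisfies the Leibniz rule. -/
theorem Derivation.iterate_prime_mul {R B : Type*} [CommRing R] [CommRing B] [Algebra R B]
    {p : ℕ} (hp : p.Prime) (hB : (p : B) = 0) (D : Derivation R B B) (f g : B) :
    D^[p] (f * g) = f * D^[p] g + g * D^[p] f := by
  have hchoose (k : ℕ) (hk0 : k ≠ 0) (hkp : k < p) : (p.choose k : B) = 0 := by
    obtain ⟨m, hm⟩ := hp.dvd_choose_self hk0 hkp
    simp [hm, hB]
  rw [D.iterate_apply_mul, Nat.sum_antidiagonal_eq_sum_range_succ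
    (fun i j => (p.choose i : B) * (D^[i] f * D^[j] g)), sum_range_succ,
    sum_eq_single_of_mem 0 (mem_range.2 hp.pos)]
  · simp [mul_comm]
  · intro k hk hk0
    rw [hchoose k hk0 (mem_range.1 hk), zero_mul]

/-- In characteristic `p`, the `p`-th iterate of a derivation satisfies the power rule. -/
theorem Derivation.iterate_prime_pow_succ {R B : Type*} [CommRing R] [CommRing B] [Algebra R B]
    {p : ℕ} (hp : p.Prime) (hB : (p : B) = 0) (D : Derivation R B B) (f : B) (n : ℕ) :
    D^[p] (f ^ (n + 1)) = (n + 1) * f ^ n * D^[p] f := by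
  induction n with
  | zero => simp
  | succ n ih =>
    rw [pow_succ, D.iterate_prime_mul hp hB, ih]
    push_cast
    ring

/-- The coefficient of `D^k` in the normally ordered expansion of `(aD)^n`. -/
def Derivation.smulPowCoeff {R B : Type*} [CommRing R] [CommRing B] [Algebra R B]
    (D : Derivation R B B) (a : B) : ℕ → ℕ → B
  | 0, 0 => 1
  | 0, _ + 1 => 0
  | n + 1, 0 => a * D (smulPowCoeff D a n 0)
  | n + 1, k + 1 => a * (D (smulPowCoeff D a n (k + 1)) + smulPowCoeff D a n k)

namespace Derivation

variable {R B : Type*} [CommRing R] [CommRing B] [Algebra R B] (D : Derivation R B B) (a : B)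

theorem smulPowCoeff_of_lt {n k : ℕ} (h : n < k) : D.smulPowCoeff a n k = 0 := by
  induction n generalizing k with
  | zero =>
    cases k with
    | zero => omega
    | succ k => rfl
  | succ n ih =>
    cases k with
    | zero => omega
    | succ k => simp [smulPowCoeff, ih (show n < k by omega), ih (show n < k + 1 by omega)]

theorem smulPowCoeff_self (n : ℕ) : D.smulPowCoeff a n n = a ^ n := by
  induction n with
  | zero => simp [smulPowCoeff]
  | succ n ih => simp [smulPowCoeff, ih, D.smulPowCoeff_of_lt a n.lt_succ_self, pow_succ']

theorem smulPowCoeff_succ_zero (n : ℕ) : D.smulPowCoeff a (n + 1) 0 = 0 := by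
  induction n with
  | zero => simp [smulPowCoeff]
  | succ n ih => rw [smulPowCoeff, ih, map_zero, mul_zero]

theorem smulPowCoeff_succ_one (n : ℕ) : D.smulPowCoeff a (n + 1) 1 = (a • D)^[n] a := by
  induction n with
  | zero => simp [smulPowCoeff]
  | succ n ih =>
    rw [smulPowCoeff, zero_add, ih, smulPowCoeff_succ_zero, add_zero,
      Function.iterate_succ_apply', smul_apply, smul_eq_mul]

/-- The normally ordered expansion of `(aD)^n`. -/
theorem iterate_smul_apply (n : ℕ) (x : B) :
    (a • D)^[n] x = ∑ k ∈ Finset.range (n + 1), D.smulPowCoeff a n k * D^[k] x := by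
  induction n with
  | zero => simp [smulPowCoeff]
  | succ n ih =>
    rw [Function.iterate_succ_apply', ih, Finset.sum_range_succ' _ (n + 1)]
    simp only [smulPowCoeff, smul_apply, map_sum, leibniz, smul_eq_mul, mul_add, add_mul,
      Finset.sum_add_distrib, ← Function.iterate_succ_apply']
    rw [add_right_comm,
      ← Finset.sum_range_succ' (fun k => a * D (D.smulPowCoeff a n k) * D^[k] x) (n + 1),
      Finset.sum_range_succ _ (n + 1), D.smulPowCoeff_of_lt a n.lt_succ_self, map_zero, mul_zero,
      zero_mul, add_zero, add_comm]
    congr 1 <;> exact Finset.sum_congr rfl fun k _ => by ring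

open Polynomial in
theorem smulPowCoeff_C {D : Derivation R B B} {E : Derivation R B[X] B[X]}
    (hE : ∀ b, E (C b) = C (D b)) (n k : ℕ) :
    E.smulPowCoeff (C a) n k = C (D.smulPowCoeff a n k) := by
  induction n generalizing k with
  | zero => cases k <;> simp [smulPowCoeff]
  | succ n ih => cases k <;> simp [smulPowCoeff, ih, hE]

open Polynomial in
theorem iterate_X_pow {E : Derivation R B[X] B[X]} (hE : E X = 1) (j k : ℕ) :
    E^[k] (X ^ j) = (j.descFactorial k : B[X]) * X ^ (j - k) := by
  induction k with
  | zero => simp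
  | succ k ih =>
    rw [Function.iterate_succ_apply', ih, leibniz, leibniz_pow, hE, map_natCast,
      Nat.descFactorial_succ, Nat.sub_sub]
    simp only [smul_eq_mul, nsmul_eq_mul]
    push_cast
    ring

open Polynomial in
theorem smulPowCoeff_prime_eq_zero (D : Derivation ℤ B B) {p : ℕ} (hp : p.Prime)
    (hB : (p : B) = 0) {j : ℕ} (hj : 1 < j) (hjp : j < p) : D.smulPowCoeff a p j = 0 := by
  obtain ⟨E, hEC, hEX⟩ : ∃ E : Derivation ℤ B[X] B[X], (∀ b, E (C b) = C (D b)) ∧ E X = 1 :=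
    letI : Differential B := ⟨D⟩
    ⟨Differential.implicitDeriv 1, Differential.implicitDeriv_C 1,
      Differential.implicitDeriv_X 1⟩
  obtain ⟨i, rfl⟩ : ∃ i, j = i + 1 := ⟨j - 1, by omega⟩
  have hB' : (p : B[X]) = 0 := by rw [← C_eq_natCast, hB, C_0]
  have key := (C a • E).iterate_prime_pow_succ hp hB' X i
  rw [E.iterate_smul_apply (C a) p (X ^ (i + 1))] at key
  simp only [smulPowCoeff_C a hEC, iterate_X_pow hEX] at key
  replace key := congrArg (eval 0) key
  rw [eval_finsetSum, Finset.sum_eq_single_of_mem (i + 1) (Finset.mem_range.2 (by omega))] at key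
  · have hunit : IsUnit ((i + 1).factorial : B) := by
      have h := Nat.Coprime.cast (R := B) (hp.coprime_factorial_of_lt hjp)
      rwa [hB, isCoprime_zero_left] at h
    refine hunit.mul_left_eq_zero.1 ?_
    rw [Nat.descFactorial_self] at key
    simpa [show i ≠ 0 by omega] using key
  · intro k _ hk
    rcases hk.lt_or_gt with hk | hk
    · simp [show i + 1 - k ≠ 0 by omega]
    · simp [Nat.descFactorial_of_lt hk]

end Derivation

/-- **Hochschild's formula.** For an `𝔽_p`-algebra `B`, a derivation `D : B → B`
and `a ∈ B`, one has `(aD)^p = a^p D^p + ((aD)^{p-1}(a)) D`. -/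
theorem hochschild_formula (p : ℕ) (hp : p.Prime) (B : Type*) [CommRing B]
    (hcharB : (p : B) = 0) (D : Derivation ℤ B B) (a : B) (x : B) :
    (⇑(a • D))^[p] x = a ^ p * (⇑D)^[p] x + ((⇑(a • D))^[p - 1] a) * D x := by
  rw [D.iterate_smul_apply, Finset.sum_range_succ,
    Finset.sum_eq_single_of_mem 1 (Finset.mem_range.2 hp.one_lt), D.smulPowCoeff_self,
    ← D.smulPowCoeff_succ_one, Nat.sub_add_cancel hp.one_le, Function.iterate_one, add_comm]
  intro k hk hk1
  rcases Nat.eq_zero_or_pos k with rfl | hk0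
  · rw [← Nat.sub_add_cancel hp.one_le, D.smulPowCoeff_succ_zero, zero_mul]
  · rw [D.smulPowCoeff_prime_eq_zero a hp hcharB (by omega) (Finset.mem_range.1 hk), zero_mul]
end

section
/- Let p be a prime, B a commutative ring in which p = 0, D : B → B a derivation, and h ∈ B such that D^[p] = h•D (i.e. D^[p](x) = h·D(x) for all x ∈ B). Then for every a ∈ B, the derivation a•D is again p-closed; explicitly, (a•D)^[p] = h₁•(a•D) where h₁ = a^{p-1}·h + D((a•D)^[p-2](a)). -/
namespace Derivation

open Finset Polynomial

variable {R B : Type*} [CommRing R] [CommRing B] [Algebra R B]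

/-- The general Leibniz rule for iterates of a derivation. -/
theorem iterate_apply_mul_s1 (D : Derivation R B B) (n : ℕ) (x y : B) :
    (⇑D)^[n] (x * y) =
      ∑ ij ∈ antidiagonal n, (n.choose ij.1 : B) * ((⇑D)^[ij.1] x * (⇑D)^[ij.2] y) := by
  induction n with
  | zero => simp
  | succ n ih =>
    rw [sum_antidiagonal_choose_succ_mul (fun i j => (⇑D)^[i] x * (⇑D)^[j] y) n]
    simp only [Function.iterate_succ_apply', ih, map_sum, leibniz, map_natCast, smul_eq_mul,
      mul_zero, add_zero, mul_add, sum_add_distrib, add_right_inj]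
    refine sum_congr rfl fun ⟨i, j⟩ hij ↦ ?_
    rw [n.choose_symm_of_eq_add (mem_antidiagonal.1 hij).symm]
    ring

/-- In characteristic `p`, the `p`-th iterate of a derivation satisfies the Leibniz rule. -/
theorem iterate_prime_apply_mul {p : ℕ} (hp : p.Prime) (hB : (p : B) = 0)
    (D : Derivation R B B) (x y : B) :
    (⇑D)^[p] (x * y) = x * (⇑D)^[p] y + (⇑D)^[p] x * y := by
  obtain ⟨q, rfl⟩ : ∃ q, p = q + 1 := ⟨p - 1, by have := hp.pos; omega⟩
  rw [iterate_apply_mul_s1, Nat.sum_antidiagonal_eq_sum_range_succ_mk, sum_range_succ,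
    sum_range_succ', sum_eq_zero fun i hi => ?_]
  · simp
  · obtain ⟨c, hc⟩ := hp.dvd_choose_self i.succ_ne_zero (by simpa using hi)
    simp only [hc, Nat.cast_mul, hB, zero_mul]

/-- The coefficients in the expansion `(a • D)^n = ∑ k, smulIterateCoeff D a n k • D^k`. -/
def smulIterateCoeff (D : Derivation R B B) (a : B) : ℕ → ℕ → B
  | 0, 0 => 1
  | 0, _ + 1 => 0
  | n + 1, 0 => a * D (smulIterateCoeff D a n 0)
  | n + 1, k + 1 => a * (D (smulIterateCoeff D a n (k + 1)) + smulIterateCoeff D a n k)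

theorem smulIterateCoeff_of_lt (D : Derivation R B B) (a : B) {n k : ℕ} (h : n < k) :
    smulIterateCoeff D a n k = 0 := by
  induction n generalizing k with
  | zero => obtain ⟨k, rfl⟩ := Nat.exists_eq_succ_of_ne_zero h.ne'; rfl
  | succ n ih =>
    obtain ⟨k, rfl⟩ := Nat.exists_eq_succ_of_ne_zero (Nat.ne_zero_of_lt h)
    simp [smulIterateCoeff, ih (show n < k by omega), ih (show n < k + 1 by omega)]

theorem smulIterateCoeff_self (D : Derivation R B B) (a : B) (n : ℕ) :
    smulIterateCoeff D a n n = a ^ n := by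
  induction n with
  | zero => simp [smulIterateCoeff]
  | succ n ih =>
    simp [smulIterateCoeff, ih, smulIterateCoeff_of_lt D a n.lt_succ_self, pow_succ']

theorem smulIterateCoeff_succ_zero (D : Derivation R B B) (a : B) (n : ℕ) :
    smulIterateCoeff D a (n + 1) 0 = 0 := by
  induction n with
  | zero => simp [smulIterateCoeff]
  | succ n ih => rw [smulIterateCoeff, ih, map_zero, mul_zero]

theorem smulIterateCoeff_succ_one (D : Derivation R B B) (a : B) (n : ℕ) :
    smulIterateCoeff D a (n + 1) 1 = (⇑(a • D))^[n] a := by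
  induction n with
  | zero => simp [smulIterateCoeff]
  | succ n ih =>
    rw [smulIterateCoeff, ih, smulIterateCoeff_succ_zero, add_zero, Function.iterate_succ_apply',
      smul_apply, smul_eq_mul]

/-- The expansion of `(a • D)^n` in powers of `D`, for any extension of `D` to a `B`-algebra. -/
theorem iterate_algebraMap_smul_apply {A : Type*} [CommRing A] [Algebra R A] [Algebra B A]
    (D : Derivation R B B) (F : Derivation R A A)
    (hF : ∀ b, F (algebraMap B A b) = algebraMap B A (D b)) (a : B) (n : ℕ) (x : A) :
    (⇑(algebraMap B A a • F))^[n] x =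
      ∑ k ∈ range (n + 1), algebraMap B A (smulIterateCoeff D a n k) * (⇑F)^[k] x := by
  induction n with
  | zero => simp [smulIterateCoeff]
  | succ n ih =>
    rw [Function.iterate_succ_apply', ih, smul_apply, map_sum]
    simp only [leibniz, hF, smul_eq_mul, ← Function.iterate_succ_apply' (⇑F), sum_add_distrib]
    rw [sum_range_succ' _ (n + 1)]
    simp only [smulIterateCoeff, map_mul, map_add, mul_add, add_mul, sum_add_distrib]
    have h := sum_range_succ' (fun k => algebraMap B A a *
      (algebraMap B A (D (smulIterateCoeff D a n k)) * (⇑F)^[k] x)) (n + 1)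
    rw [sum_range_succ, smulIterateCoeff_of_lt D a n.lt_succ_self] at h
    simp only [map_zero, zero_mul, mul_zero, add_zero] at h
    simp only [mul_sum, mul_assoc, mul_comm ((⇑F)^[_] x)] at h ⊢
    rw [h]
    ring

/-- The extension of a derivation `D` of `B` to `B[X]` which sends `X` to `1`. -/
noncomputable def polynomialExtension (D : Derivation R B B) : Derivation R B[X] B[X] :=
  PolynomialModule.equivPolynomialSelf.compDer D.mapCoeffs + derivative'.restrictScalars R

theorem polynomialExtension_C (D : Derivation R B B) (b : B) :
    D.polynomialExtension (C b) = C (D b) := by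
  simp [polynomialExtension]

theorem polynomialExtension_X (D : Derivation R B B) :
    D.polynomialExtension X = 1 := by
  simp [polynomialExtension]

theorem iterate_polynomialExtension_X_pow (D : Derivation R B B) (m k : ℕ) :
    (⇑D.polynomialExtension)^[k] (X ^ m) = (m.descFactorial k : B[X]) * X ^ (m - k) := by
  induction k with
  | zero => simp
  | succ k ih =>
    rw [Function.iterate_succ_apply', ih, leibniz, map_natCast, leibniz_pow,
      polynomialExtension_X, Nat.descFactorial_succ]
    simp [Nat.sub_sub]
    ring

theorem smulIterateCoeff_prime_eq_zero {p : ℕ} (hp : p.Prime) (hB : (p : B) = 0)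
    (D : Derivation R B B) (a : B) {m : ℕ} (hm : 2 ≤ m) (hmp : m < p) :
    smulIterateCoeff D a p m = 0 := by
  have expand := iterate_algebraMap_smul_apply D D.polynomialExtension
    (fun b => D.polynomialExtension_C b) a p (X ^ m)
  obtain ⟨r, rfl⟩ : ∃ r, m = r + 1 := ⟨m - 1, by omega⟩
  have hBX : (p : B[X]) = 0 := by rw [← C_eq_natCast, hB, C_0]
  nth_rw 1 [pow_succ] at expand
  rw [iterate_prime_apply_mul hp hBX] at expand
  replace expand := congrArg (eval 0) expand
  simp only [iterate_polynomialExtension_X_pow, algebraMap_eq, eval_add, eval_mul, eval_pow,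
    eval_X, mul_zero, add_zero, zero_pow (show r ≠ 0 by omega), zero_mul, eval_finsetSum, eval_C,
    eval_natCast] at expand
  rw [sum_eq_single (r + 1) (fun k _ hk => ?_) (by simp; omega)] at expand
  · rw [Nat.descFactorial_self, Nat.sub_self, pow_zero, mul_one] at expand
    have hu : IsUnit (((r + 1).factorial : ℕ) : B) := by
      have hc : Nat.Coprime (r + 1).factorial p :=
        (hp.coprime_iff_not_dvd.2 (by rw [hp.dvd_factorial]; omega)).symm
      have := (Nat.isCoprime_iff_coprime.2 hc).map (Int.castRingHom B)
      simpa [hB, isCoprime_zero_right] using this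
    exact hu.mul_left_eq_zero.1 expand.symm
  · rcases hk.lt_or_gt with h | h
    · rw [zero_pow (by omega), mul_zero, mul_zero]
    · rw [Nat.descFactorial_of_lt h, Nat.cast_zero, zero_mul, mul_zero]

/-- **Hochschild's formula**: in characteristic `p`,
`(a • D)^p = a^p • D^p + (a • D)^{p-1}(a) • D`. -/
theorem iterate_prime_smul_apply {p : ℕ} (hp : p.Prime) (hB : (p : B) = 0)
    (D : Derivation R B B) (a x : B) :
    (⇑(a • D))^[p] x = a ^ p * (⇑D)^[p] x + (⇑(a • D))^[p - 1] a * D x := by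
  have expand := iterate_algebraMap_smul_apply D D (fun _ => rfl) a p x
  simp only [Algebra.algebraMap_self, RingHom.id_apply] at expand
  rw [expand, sum_range_succ, smulIterateCoeff_self, add_comm, add_right_inj,
    sum_eq_single 1 (fun k hk hk1 => ?_) (by simp [hp.one_lt])]
  · obtain ⟨q, rfl⟩ : ∃ q, p = q + 1 := ⟨p - 1, by have := hp.pos; omega⟩
    rw [smulIterateCoeff_succ_one]
    simp
  · rcases Nat.eq_zero_or_pos k with rfl | hk0
    · obtain ⟨q, rfl⟩ : ∃ q, p = q + 1 := ⟨p - 1, by have := hp.pos; omega⟩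
      rw [smulIterateCoeff_succ_zero, zero_mul]
    · rw [smulIterateCoeff_prime_eq_zero hp hB D a (by omega) (mem_range.1 hk), zero_mul]

end Derivation


/-- If `D` is a `p`-closed derivation on an `𝔽_p`-algebra `B`, with `D^[p] = h • D`,
then for every `a ∈ B` the derivation `a • D` is again `p`-closed, with explicit
multiplier `h₁ = a^{p-1} h + D((aD)^{p-2}(a))`. -/
theorem smul_derivation_pClosed (p : ℕ) (hp : p.Prime) (B : Type*) [CommRing B]
    (hcharB : (p : B) = 0) (D : Derivation ℤ B B) (h : B)
    (hD : ∀ x, (⇑D)^[p] x = h * D x) (a : B) :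
    ∀ x, (⇑(a • D))^[p] x =
      (a ^ (p - 1) * h + D ((⇑(a • D))^[p - 2] a)) * (a • D) x := by
  intro x
  obtain ⟨q, rfl⟩ : ∃ q, p = q + 2 := ⟨p - 2, by have := hp.two_le; omega⟩
  rw [D.iterate_prime_smul_apply hp hcharB, hD, show q + 2 - 1 = q + 1 by omega,
    Nat.add_sub_cancel, Function.iterate_succ_apply', Derivation.smul_apply,
    Derivation.smul_apply, smul_eq_mul, smul_eq_mul]
  ring
end

section
/- Let p be a prime, B a reduced commutative ring in which p = 0, D : B → B a derivation, and h ∈ B with D^[p] = h•D. Then D(h) = 0. -/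
/-- If `D` is a `p`-closed derivation on a reduced `𝔽_p`-algebra `B`
with `D^[p] = h • D`, then `D(h) = 0`. -/
theorem deriv_multiplier_eq_zero_of_reduced (p : ℕ) (hp : p.Prime) (B : Type*) [CommRing B]
    [IsReduced B] (hcharB : (p : B) = 0) (D : Derivation ℤ B B) (h : B)
    (hD : ∀ x, (⇑D)^[p] x = h * D x) :
    D h = 0 := by
  have h₁ : D ((⇑D)^[p] h) = (⇑D)^[p] (D h) :=
    (Function.iterate_succ_apply' (⇑D) p h).symm.trans
      (Function.iterate_succ_apply (⇑D) p h)
  rw [hD, hD, D.leibniz, smul_eq_mul, smul_eq_mul] at h₁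
  have h₂ : D h ^ 2 = 0 := by linear_combination h₁
  exact eq_zero_of_pow_eq_zero h₂
end

section
/- Let p be a prime, B a commutative ring in which p = 0, D : B → B a derivation, and h ∈ B with D^[p] = h•D. Suppose the image of D contains a regular element of B (i.e. there exists a ∈ B such that D(a) is a non-zero-divisor). Then D(h) = 0. -/
/-- If `D` is a `p`-closed derivation on an `𝔽_p`-algebra `B` with `D^[p] = h • D`,
and the image of `D` contains a regular element (non-zero-divisor), then `D(h) = 0`. -/
theorem deriv_multiplier_eq_zero_of_regular (p : ℕ) (hp : p.Prime) (B : Type*) [CommRing B]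
    (hcharB : (p : B) = 0) (D : Derivation ℤ B B) (h : B)
    (hD : ∀ x, (⇑D)^[p] x = h * D x)
    (hreg : ∃ a : B, D a ∈ nonZeroDivisors B) :
    D h = 0 := by
  obtain ⟨a, ha⟩ := hreg
  have key : h * D (D a) = D (h * D a) := by
    rw [← hD, ← hD, ← Function.iterate_succ_apply, Function.iterate_succ_apply']
  rw [D.leibniz, smul_eq_mul, smul_eq_mul, left_eq_add, mul_comm] at key
  exact (mul_right_mem_nonZeroDivisors_eq_zero_iff ha).mp key
end

section
/- Let p be a prime, k a field of characteristic p, and B = k[T]/(T^p), with t the image of T in B. Then there exists a k-derivation D : B → B with D(t) = t, and every such D satisfies: (i) D^[p] = (1 + t^{p-1})•D; (ii) D(1 + t^{p-1}) = −t^{p-1} ≠ 0; (iii) D^[p] = 1•D = D (so D is also p-closed with multiplier h' = 1, and D(1) = 0). In particular, for a non-reduced F_p-algebra, a p-closed derivation D can satisfy D^[p] = h•D with D(h) ≠ 0. -/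
namespace Derivation

open Polynomial

variable {k A : Type*} [CommRing k] [CommRing A] [Algebra k A]

theorem apply_pow_of_apply_eq_self (D : Derivation k A A) {t : A} (ht : D t = t) (n : ℕ) :
    D (t ^ n) = (n : k) • t ^ n := by
  rcases n with _ | n
  · simp
  · rw [leibniz_pow, ht, Nat.add_sub_cancel, smul_eq_mul, ← pow_succ, Nat.cast_smul_eq_nsmul]

theorem iterate_apply_smul_pow (D : Derivation k A A) {t : A} (ht : D t = t) (c : k) (n m : ℕ) :
    D^[m] (c • t ^ n) = (c * (n : k) ^ m) • t ^ n := by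
  induction m with
  | zero => simp
  | succ m ih =>
    rw [Function.iterate_succ_apply', ih, map_smul, apply_pow_of_apply_eq_self D ht, smul_smul,
      pow_succ, mul_assoc]

theorem iterate_prime_aeval (p : ℕ) [Fact p.Prime] [CharP k p] (D : Derivation k A A) {t : A}
    (ht : D t = t) (f : k[X]) : D^[p] (aeval t f) = D (aeval t f) := by
  induction f using Polynomial.induction_on' with
  | add f g hf hg => rw [map_add, iterate_map_add, hf, hg, map_add]
  | monomial n c =>
    rw [aeval_monomial, ← Algebra.smul_def, iterate_apply_smul_pow D ht, map_smul,
      apply_pow_of_apply_eq_self D ht, smul_smul]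
    congr 2
    exact _root_.map_natCast (frobenius k p) n

theorem dvd_apply_aeval (D : Derivation k A A) {t : A} (ht : D t = t) (f : k[X]) :
    t ∣ D (aeval t f) := by
  induction f using Polynomial.induction_on' with
  | add f g hf hg => simpa only [map_add] using dvd_add hf hg
  | monomial n c =>
    rw [aeval_monomial, ← Algebra.smul_def, map_smul, leibniz_pow, ht, smul_eq_mul]
    exact dvd_smul_of_dvd _ (dvd_smul_of_dvd _ (dvd_mul_left _ _))

theorem exists_apply_mk_X_eq_mk_X (k : Type*) [CommRing k] (n : ℕ) :
    ∃ D : Derivation k (k[X] ⧸ Ideal.span {(X : k[X]) ^ n}) (k[X] ⧸ Ideal.span {(X : k[X]) ^ n}),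
      D (Ideal.Quotient.mk _ X) = Ideal.Quotient.mk _ X := by
  let f := Ideal.Quotient.mkₐ k (Ideal.span {(X : k[X]) ^ n})
  let d : Derivation k k[X] k[X] := mkDerivation k X
  have hd : ∀ x, f x = 0 → f (d x) = 0 := by
    intro x hx
    obtain ⟨y, rfl⟩ := Ideal.mem_span_singleton.mp (Ideal.Quotient.eq_zero_iff_mem.mp hx)
    refine Ideal.Quotient.eq_zero_iff_mem.mpr (Ideal.mem_span_singleton.mpr ?_)
    have hX : d X = X := mkDerivation_X k X
    rw [leibniz, apply_pow_of_apply_eq_self d hX, smul_eq_mul, smul_eq_mul]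
    exact dvd_add (dvd_mul_right _ _)
      (dvd_mul_of_dvd_right (dvd_smul_of_dvd _ dvd_rfl) _)
  refine ⟨liftOfSurjective (Ideal.Quotient.mkₐ_surjective k _) hd, ?_⟩
  exact (liftOfSurjective_apply (Ideal.Quotient.mkₐ_surjective k _) hd X).trans
    (congrArg f (mkDerivation_X k X))

end Derivation

set_option synthInstance.maxHeartbeats 1000000 in
/-- On `B = k[T]/(T^p)` (with `k` of characteristic `p` and `t` the image of `T`),
there is a `k`-derivation `D` with `D(t) = t`, and any such `D` satisfies
`D^[p] = (1 + t^{p-1}) • D` with `D(1 + t^{p-1}) = -t^{p-1} ≠ 0`, while also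
`D^[p] = 1 • D = D` with `D(1) = 0`. -/
theorem example_nonreduced_pClosed (p : ℕ) (hp : p.Prime) (k : Type*) [Field k] [CharP k p] :
    ∀ t : Polynomial k ⧸ Ideal.span {(Polynomial.X : Polynomial k) ^ p},
      t = Ideal.Quotient.mk (Ideal.span {(Polynomial.X : Polynomial k) ^ p}) Polynomial.X →
      ((∃ D : Derivation k (Polynomial k ⧸ Ideal.span {(Polynomial.X : Polynomial k) ^ p})
            (Polynomial k ⧸ Ideal.span {(Polynomial.X : Polynomial k) ^ p}), D t = t) ∧
       (∀ D : Derivation k (Polynomial k ⧸ Ideal.span {(Polynomial.X : Polynomial k) ^ p})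
            (Polynomial k ⧸ Ideal.span {(Polynomial.X : Polynomial k) ^ p}), D t = t →
          ((∀ x, (⇑D)^[p] x = (1 + t ^ (p - 1)) * D x) ∧
           (D (1 + t ^ (p - 1)) = -(t ^ (p - 1)) ∧ t ^ (p - 1) ≠ 0) ∧
           ((∀ x, (⇑D)^[p] x = 1 * D x) ∧ D 1 = 0)))) := by
  have : Fact p.Prime := ⟨hp⟩
  rintro t rfl
  refine ⟨Derivation.exists_apply_mk_X_eq_mk_X k p, fun D hD => ?_⟩
  set t := Ideal.Quotient.mk (Ideal.span {(Polynomial.X : Polynomial k) ^ p}) Polynomial.X with ht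
  have htp : t ^ p = 0 := by
    rw [ht, ← map_pow]
    exact Ideal.Quotient.eq_zero_iff_mem.mpr (Ideal.mem_span_singleton_self _)
  have hp1 : p - 1 + 1 = p := Nat.sub_add_cancel hp.one_le
  have aeval_surj : ∀ x, ∃ f : Polynomial k, Polynomial.aeval t f = x := by
    intro x
    obtain ⟨f, rfl⟩ := Ideal.Quotient.mkₐ_surjective k _ x
    refine ⟨f, ?_⟩
    have h := Polynomial.aeval_algHom_apply
      (Ideal.Quotient.mkₐ k (Ideal.span {(Polynomial.X : Polynomial k) ^ p})) Polynomial.X f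
    rwa [Polynomial.aeval_X_left_apply] at h
  have iterate_eq : ∀ x, (⇑D)^[p] x = D x := by
    intro x
    obtain ⟨f, rfl⟩ := aeval_surj x
    exact D.iterate_prime_aeval p hD f
  have pow_mul_apply : ∀ x, t ^ (p - 1) * D x = 0 := by
    intro x
    obtain ⟨f, rfl⟩ := aeval_surj x
    obtain ⟨y, hy⟩ := D.dvd_apply_aeval hD f
    rw [hy, ← mul_assoc, ← pow_succ, hp1, htp, zero_mul]
  refine ⟨fun x => ?_, ⟨?_, fun h => ?_⟩, fun x => ?_, D.map_one_eq_zero⟩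
  · rw [iterate_eq, add_mul, one_mul, pow_mul_apply, add_zero]
  · rw [map_add, D.map_one_eq_zero, zero_add, D.apply_pow_of_apply_eq_self hD,
      Nat.cast_sub hp.one_le, CharP.cast_eq_zero, Nat.cast_one, zero_sub, neg_one_smul]
  · rw [ht, ← map_pow] at h
    have hdvd := Ideal.mem_span_singleton.mp (Ideal.Quotient.eq_zero_iff_mem.mp h)
    have := (pow_dvd_pow_iff Polynomial.X_ne_zero Polynomial.not_isUnit_X).mp hdvd
    omega
  · rw [iterate_eq, one_mul]
end

section
/- Let p be a prime, B a commutative ring in which p = 0, D : B → B a derivation, and h ∈ B with D^[p] = h•D and D(h) = 0. Suppose u is a unit of B with u^{p-1} = h. Then the derivation E := u^{-1}•D is of multiplicative type, i.e. E^[p] = E. -/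
/-- Iterates of `a • D` when `a` is a constant of the derivation `D`. -/
theorem Derivation.iterate_smul_of_apply_eq_zero {R B : Type*} [CommSemiring R] [CommRing B]
    [Algebra R B] (D : Derivation R B B) {a : B} (ha : D a = 0) (n : ℕ) (x : B) :
    (⇑(a • D))^[n] x = a ^ n * (⇑D)^[n] x := by
  induction n with
  | zero => simp
  | succ n ih =>
    have han : D (a ^ n) = 0 := by simp [Derivation.leibniz_pow, ha]
    rw [Function.iterate_succ_apply', ih, Function.iterate_succ_apply', Derivation.smul_apply,
      Derivation.leibniz, han, smul_zero, add_zero, smul_eq_mul, smul_eq_mul]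
    ring

/-- If `D^[p] = h • D`, `D(h) = 0`, and `h = u^{p-1}` for a unit `u`, then the derivation
`E = u⁻¹ • D` is of multiplicative type: `E^[p] = E`. -/
theorem multiplicative_type_of_unit_multiplier (p : ℕ) (hp : p.Prime) (B : Type*) [CommRing B]
    (hcharB : (p : B) = 0) (D : Derivation ℤ B B) (h : B)
    (hD : ∀ x, (⇑D)^[p] x = h * D x) (hDh : D h = 0)
    (u : Bˣ) (hu : (u : B) ^ (p - 1) = h) :
    ∀ x, (⇑((((u⁻¹ : Bˣ) : B)) • D))^[p] x = (((u⁻¹ : Bˣ) : B) • D) x := by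
  intro x
  have hup : (u : B) ^ p = h * u := by rw [← hu, pow_sub_one_mul hp.ne_zero]
  have hDup : D ((u : B) ^ p) = 0 := by
    rw [Derivation.leibniz_pow, ← Nat.cast_smul_eq_nsmul B, hcharB, zero_smul]
  have hDu : D (u : B) = 0 := by
    rw [hup, Derivation.leibniz, hDh, smul_zero, add_zero, smul_eq_mul, ← hu] at hDup
    exact (u.isUnit.pow (p - 1)).mul_right_eq_zero.mp hDup
  have hDinv : D ((u⁻¹ : Bˣ) : B) = 0 := by
    have h1 : D ((u : B) * ((u⁻¹ : Bˣ) : B)) = 0 := by rw [Units.mul_inv, D.map_one_eq_zero]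
    rw [Derivation.leibniz, hDu, smul_zero, add_zero, smul_eq_mul] at h1
    exact u.isUnit.mul_right_eq_zero.mp h1
  rw [D.iterate_smul_of_apply_eq_zero hDinv, hD, Derivation.smul_apply, smul_eq_mul, ← hu,
    ← pow_sub_one_mul hp.ne_zero ((u⁻¹ : Bˣ) : B), mul_mul_mul_comm, ← mul_pow,
    Units.inv_mul, one_pow, one_mul]
end

section
/- Let k be a field of characteristic 2. Then the complete local rings C₁' = k⟦x, y, z⟧/(x² + z³ + y²z·(y³ + z·x)) and C₁ = k⟦w, z, Y⟧/(w² + Y³ + z⁴·(z·Y + z³·w)) are isomorphic as k-algebras. (An explicit isomorphism φ : C₁' → C₁ is given by φ(x) = (w + Y²z²)·(1 + Yz⁴)⁻¹, φ(y) = z, φ(z) = (Y + z²w)·(1 + Yz⁴)⁻¹.) -/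
open MvPowerSeries

namespace MvPowerSeries

variable {σ R : Type*} [CommRing R]

/-- A quadratic equation `a η² + b η = c` over a ring of power series, with `b` a unit and `c`
without constant term, has a solution without constant term. -/
theorem exists_root_quadratic {a b c : MvPowerSeries σ R} (hb : IsUnit b)
    (hc : constantCoeff c = 0) :
    ∃ η : MvPowerSeries σ R, constantCoeff η = 0 ∧ a * η ^ 2 + b * η = c := by
  obtain ⟨v, hv⟩ := hb.exists_right_inv
  have ht : PowerSeries.HasSubst (-(a * c * v ^ 2)) :=
    PowerSeries.HasSubst.of_constantCoeff_zero (by simp [hc])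
  have hg := congrArg (fun f ↦ PowerSeries.substAlgHom (R := R) ht
    (PowerSeries.map (Nat.castRingHom R) f)) PowerSeries.catalanSeries_sq_mul_X_add_one
  simp only [map_add, map_mul, map_pow, map_one, PowerSeries.map_X,
    PowerSeries.substAlgHom_X] at hg
  set g := PowerSeries.substAlgHom (R := R) ht
    (PowerSeries.map (Nat.castRingHom R) PowerSeries.catalanSeries)
  exact ⟨c * v * g, by simp [hc], by linear_combination c * g * hv - c * hg⟩

/-- Solutions without constant term of `a η² + b η = c`, with `b` a unit, are unique. -/
theorem root_quadratic_unique {a b η θ : MvPowerSeries σ R} (hb : IsUnit b)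
    (hη : constantCoeff η = 0) (hθ : constantCoeff θ = 0)
    (h : a * η ^ 2 + b * η = a * θ ^ 2 + b * θ) : η = θ := by
  have hu : IsUnit (a * (η + θ) + b) := by
    rw [isUnit_iff_constantCoeff] at hb ⊢
    simpa [hη, hθ] using hb
  rw [← sub_eq_zero, ← hu.mul_left_eq_zero]
  linear_combination h

/-- Substitutions that are mutually inverse on the variables form an automorphism. -/
noncomputable def substAlgEquiv {a b : σ → MvPowerSeries σ R} (ha : HasSubst a) (hb : HasSubst b)
    (hab : ∀ s, substAlgHom (R := R) hb (a s) = X s)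
    (hba : ∀ s, substAlgHom (R := R) ha (b s) = X s) :
    MvPowerSeries σ R ≃ₐ[R] MvPowerSeries σ R :=
  AlgEquiv.ofAlgHom (substAlgHom ha) (substAlgHom hb)
    (by
      ext1 f
      rw [AlgHom.comp_apply, substAlgHom_comp_substAlgHom_apply, substAlgHom_apply, funext hba]
      exact congrFun subst_self f)
    (by
      ext1 f
      rw [AlgHom.comp_apply, substAlgHom_comp_substAlgHom_apply, substAlgHom_apply, funext hab]
      exact congrFun subst_self f)

end MvPowerSeries

section CharTwo

variable {A : Type*} [CommRing A] {w y Y v : A}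

/-- Substituting `x = (w + Y²y²)v`, `z = (Y + y²w)v` with `v = (1 + Yy⁴)⁻¹` turns the first
equation into `v` times the second. -/
theorem E13_equation_transform (h2 : (2 : A) = 0) (huv : (1 + Y * y ^ 4) * v = 1) :
    ((w + Y ^ 2 * y ^ 2) * v) ^ 2 + ((Y + y ^ 2 * w) * v) ^ 3 +
      y ^ 2 * ((Y + y ^ 2 * w) * v) * (y ^ 3 + (Y + y ^ 2 * w) * v * ((w + Y ^ 2 * y ^ 2) * v)) =
    (w ^ 2 + Y ^ 3 + y ^ 4 * (y * Y + y ^ 3 * w)) * v := by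
  linear_combination
    v ^ 3 * (3 * w * Y ^ 2 * y ^ 2 + 2 * Y * w ^ 2 * y ^ 4 + 2 * w * Y ^ 3 * y ^ 6 +
      y ^ 6 * w ^ 3) * h2 -
    ((w + Y ^ 2 * y ^ 2) ^ 2 * v ^ 2 - (w ^ 2 + Y ^ 3) * v * (1 + (1 + Y * y ^ 4) * v)) * huv

/-- The variable `Y` satisfies a quadratic equation over the subring generated by the images
of `x`, `y` and `z`. -/
theorem E13_quadratic_relation (h2 : (2 : A) = 0) (huv : (1 + Y * y ^ 4) * v = 1) :
    y ^ 4 * Y ^ 2 + (1 + (w + Y ^ 2 * y ^ 2) * v * y ^ 6 + (Y + y ^ 2 * w) * v * y ^ 4) * Y =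
      (Y + y ^ 2 * w) * v + y ^ 2 * ((w + Y ^ 2 * y ^ 2) * v) := by
  linear_combination
    (Y * y ^ 4 * (Y + 2 * y ^ 2 * w + Y ^ 2 * y ^ 4) * v - y ^ 2 * w) * h2 -
    (Y + 2 * y ^ 2 * w + Y ^ 2 * y ^ 4) * huv

end CharTwo

/-- In characteristic 2, the complete local rings
`C₁' = k⟦x,y,z⟧/(x² + z³ + y²z(y³ + zx))` and `C₁ = k⟦w,z,Y⟧/(w² + Y³ + z⁴(zY + z³w))`
are isomorphic as `k`-algebras. Here both ambient rings are `MvPowerSeries (Fin 3) k`,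
with variables `(x, y, z) = (X 0, X 1, X 2)` for the first ring and
`(w, z, Y) = (X 0, X 1, X 2)` for the second. -/
theorem E13_presentations_isomorphic (k : Type*) [Field k] [CharP k 2] :
    Nonempty
      ((MvPowerSeries (Fin 3) k ⧸ Ideal.span
          {(MvPowerSeries.X 0 : MvPowerSeries (Fin 3) k) ^ 2 + (MvPowerSeries.X 2) ^ 3 +
            (MvPowerSeries.X 1) ^ 2 * MvPowerSeries.X 2 *
              ((MvPowerSeries.X 1) ^ 3 + MvPowerSeries.X 2 * MvPowerSeries.X 0)}) ≃ₐ[k]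
       (MvPowerSeries (Fin 3) k ⧸ Ideal.span
          {(MvPowerSeries.X 0 : MvPowerSeries (Fin 3) k) ^ 2 + (MvPowerSeries.X 2) ^ 3 +
            (MvPowerSeries.X 1) ^ 4 *
              (MvPowerSeries.X 1 * MvPowerSeries.X 2 +
                (MvPowerSeries.X 1) ^ 3 * MvPowerSeries.X 0)})) := by
  set x : MvPowerSeries (Fin 3) k := X 0
  set y : MvPowerSeries (Fin 3) k := X 1
  set z : MvPowerSeries (Fin 3) k := X 2
  have hx : constantCoeff x = 0 := constantCoeff_X 0
  have hy : constantCoeff y = 0 := constantCoeff_X 1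
  have hz : constantCoeff z = 0 := constantCoeff_X 2
  have h2 : (2 : MvPowerSeries (Fin 3) k) = 0 := by
    rw [← map_ofNat (C (σ := Fin 3) (R := k)) 2, CharTwo.two_eq_zero, map_zero]
  have hu : IsUnit (1 + z * y ^ 4) := by simp [isUnit_iff_constantCoeff, hy]
  obtain ⟨v, hv⟩ := hu.exists_right_inv
  let a : Fin 3 → MvPowerSeries (Fin 3) k :=
    ![(x + z ^ 2 * y ^ 2) * v, y, (z + y ^ 2 * x) * v]
  have ha : HasSubst a := hasSubst_of_constantCoeff_zero fun s ↦ by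
    fin_cases s <;> simp [a, hx, hy, hz]
  have hb : IsUnit (1 + x * y ^ 6 + z * y ^ 4) := by simp [isUnit_iff_constantCoeff, hy]
  obtain ⟨η, hη, hηeq⟩ := exists_root_quadratic (a := y ^ 4) (c := z + y ^ 2 * x) hb
    (by simp [hy, hz])
  let b : Fin 3 → MvPowerSeries (Fin 3) k := ![x * (1 + η * y ^ 4) + η ^ 2 * y ^ 2, y, η]
  have hb' : HasSubst b := hasSubst_of_constantCoeff_zero fun s ↦ by
    fin_cases s <;> simp [b, hx, hy, hη]
  have hax : substAlgHom (R := k) ha x = (x + z ^ 2 * y ^ 2) * v := substAlgHom_X ha 0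
  have hay : substAlgHom (R := k) ha y = y := substAlgHom_X ha 1
  have haz : substAlgHom (R := k) ha z = (z + y ^ 2 * x) * v := substAlgHom_X ha 2
  have hbx : substAlgHom (R := k) hb' x = x * (1 + η * y ^ 4) + η ^ 2 * y ^ 2 :=
    substAlgHom_X hb' 0
  have hby : substAlgHom (R := k) hb' y = y := substAlgHom_X hb' 1
  have hbz : substAlgHom (R := k) hb' z = η := substAlgHom_X hb' 2
  have haη : substAlgHom (R := k) ha η = z := by
    have h := congrArg (substAlgHom (R := k) ha) hηeq
    simp only [map_add, map_mul, map_pow, map_one, hax, hay, haz] at h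
    refine root_quadratic_unique (a := y ^ 4)
      (b := 1 + (x + z ^ 2 * y ^ 2) * v * y ^ 6 + (z + y ^ 2 * x) * v * y ^ 4) ?_ ?_ hz
      (h.trans (E13_quadratic_relation h2 hv).symm)
    · simp [isUnit_iff_constantCoeff, hy]
    · rw [substAlgHom_apply]
      exact constantCoeff_subst_eq_zero ha (fun s ↦ by fin_cases s <;> simp [a, hx, hy, hz]) hη
  have hbv := congrArg (substAlgHom (R := k) hb') hv
  simp only [map_add, map_mul, map_pow, map_one, hby, hbz] at hbv
  have hab : ∀ s, substAlgHom (R := k) hb' (a s) = X s := by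
    intro s
    fin_cases s
    · change substAlgHom (R := k) hb' ((x + z ^ 2 * y ^ 2) * v) = x
      simp only [map_add, map_mul, map_pow, hbx, hby, hbz]
      linear_combination x * hbv + η ^ 2 * y ^ 2 * substAlgHom (R := k) hb' v * h2
    · exact hby
    · change substAlgHom (R := k) hb' ((z + y ^ 2 * x) * v) = z
      simp only [map_add, map_mul, map_pow, hbx, hby, hbz]
      linear_combination substAlgHom (R := k) hb' v * hηeq + z * hbv +
        (y ^ 2 * x - z * y ^ 4 * η) * substAlgHom (R := k) hb' v * h2
  have hba : ∀ s, substAlgHom (R := k) ha (b s) = X s := by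
    intro s
    fin_cases s
    · change substAlgHom (R := k) ha (x * (1 + η * y ^ 4) + η ^ 2 * y ^ 2) = x
      simp only [map_add, map_mul, map_pow, map_one, hax, hay, haη]
      linear_combination (x + z ^ 2 * y ^ 2) * hv + z ^ 2 * y ^ 2 * h2
    · exact hay
    · exact haη
  refine ⟨Ideal.quotientEquivAlg _ _ (substAlgEquiv ha hb' hab hba) ?_⟩
  rw [Ideal.map_span, Set.image_singleton, eq_comm]
  change Ideal.span {substAlgHom (R := k) ha _} = _
  simp only [map_add, map_mul, map_pow, hax, hay, haz]
  rw [E13_equation_transform h2 hv]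
  exact Ideal.span_singleton_mul_right_unit (IsUnit.of_mul_eq_one_right _ hv) _
end
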